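/- Let H be a separable complex Hilbert space with dim(H) ≥ 3. Then there is no Intensive State of Affairs Ψ on H taking only the values 0 and 1; that is, Gleason's theorem excludes any {0,1}-valued countably additive probability assignment on the orthogonal projections of H with Ψ(1) = 1. -/

import Mathlib

open scoped ComplexInnerProductSpace

/-- `P` is an orthogonal projection: a self-adjoint idempotent bounded operator. -/
def IsProjection {H : Type*} [NormedAddCommGroup H] [InnerProductSpace ℂ H] [CompleteSpace H]
    (P : H →L[ℂ] H) : Prop :=
  IsSelfAdjoint P ∧ P ∘L P = P

/-- An Intensive State of Affairs (ISA): a map assigning to every orthogonal projection a value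
in `[0,1]`, with `Ψ 1 = 1`, that is countably additive on pairwise orthogonal families of
projections whose sum converges strongly to a projection. -/
def IsISA {H : Type*} [NormedAddCommGroup H] [InnerProductSpace ℂ H] [CompleteSpace H]
    (Ψ : (H →L[ℂ] H) → ℝ) : Prop :=
  (∀ P : H →L[ℂ] H, IsProjection P → Ψ P ∈ Set.Icc (0 : ℝ) 1) ∧
  Ψ 1 = 1 ∧
  ∀ (P : ℕ → H →L[ℂ] H) (Q : H →L[ℂ] H),
    (∀ i, IsProjection (P i)) → IsProjection Q →
    (∀ i j, i ≠ j → P i ∘L P j = 0) →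
    (∀ x : H, HasSum (fun i => P i x) (Q x)) →
    HasSum (fun i => Ψ (P i)) (Ψ Q)

/-- A predicate on vectors of `ℝ³` that never holds for two orthogonal vectors and holds for some
member of every orthogonal triple of nonzero vectors. -/
structure IsKSColoring (g : ℝ → ℝ → ℝ → Prop) : Prop where
  pair : ∀ {x y z x' y' z' : ℝ}, g x y z → x * x' + y * y' + z * z' = 0 → ¬ g x' y' z'
  triple : ∀ x y z x' y' z' x'' y'' z'' : ℝ,
    x * x' + y * y' + z * z' = 0 → x * x'' + y * y'' + z * z'' = 0 →
    x' * x'' + y' * y'' + z' * z'' = 0 →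
    x * x + y * y + z * z ≠ 0 → x' * x' + y' * y' + z' * z' ≠ 0 →
    x'' * x'' + y'' * y'' + z'' * z'' ≠ 0 →
    g x y z ∨ g x' y' z' ∨ g x'' y'' z''

namespace IsKSColoring

variable {g : ℝ → ℝ → ℝ → Prop}

lemma swap (hg : IsKSColoring g) : IsKSColoring fun x y z => g y x z where
  pair h h' := hg.pair h (by linarith)
  triple x y z x' y' z' x'' y'' z'' h₁ h₂ h₃ n₁ n₂ n₃ := by
    rw [add_comm (x * x)] at n₁
    rw [add_comm (x' * x')] at n₂
    rw [add_comm (x'' * x'')] at n₃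
    exact hg.triple _ _ _ _ _ _ _ _ _ (by linarith) (by linarith) (by linarith) n₁ n₂ n₃

lemma rotate (hg : IsKSColoring g) : IsKSColoring fun x y z => g z x y where
  pair h h' := hg.pair h (by linarith)
  triple x y z x' y' z' x'' y'' z'' h₁ h₂ h₃ n₁ n₂ n₃ := by
    rw [add_comm _ (z * z), ← add_assoc] at n₁
    rw [add_comm _ (z' * z'), ← add_assoc] at n₂
    rw [add_comm _ (z'' * z''), ← add_assoc] at n₃
    exact hg.triple _ _ _ _ _ _ _ _ _ (by linarith) (by linarith) (by linarith) n₁ n₂ n₃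

lemma reflect (hg : IsKSColoring g) : IsKSColoring fun x y z => g (-x) y z where
  pair h h' := hg.pair h (by linarith)
  triple x y z x' y' z' x'' y'' z'' h₁ h₂ h₃ n₁ n₂ n₃ := by
    rw [← neg_mul_neg x] at n₁
    rw [← neg_mul_neg x'] at n₂
    rw [← neg_mul_neg x''] at n₃
    exact hg.triple _ _ _ _ _ _ _ _ _ (by linarith) (by linarith) (by linarith) n₁ n₂ n₃

/-- The forcing chain in Peres's set of 33 rays. -/
lemma false_of_peres (hg : IsKSColoring g) {s : ℝ} (hs : s * s = 2)
    (hz : g 0 0 1) (hxz : g 1 0 1) (hyz : g 0 1 1) (hxyz : g 1 (-1) s) : False := by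
  have hx : ¬ g 1 0 0 := hg.pair hz (by norm_num)
  have hy : ¬ g 0 1 0 := hg.pair hz (by norm_num)
  have hxy : ¬ g 1 (-1) 0 := hg.pair hz (by norm_num)
  have hyz' : ¬ g 0 (-1) 1 := hg.pair hyz (by norm_num)
  have hxz' : ¬ g (-1) 0 1 := hg.pair hxz (by norm_num)
  have force {x y z x' y' z' x'' y'' z'' : ℝ} (h' : ¬ g x' y' z') (h'' : ¬ g x'' y'' z'')
      (h₁ : x * x' + y * y' + z * z' = 0) (h₂ : x * x'' + y * y'' + z * z'' = 0)
      (h₃ : x' * x'' + y' * y'' + z' * z'' = 0)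
      (n₁ : 0 < x * x + y * y + z * z) (n₂ : 0 < x' * x' + y' * y' + z' * z')
      (n₃ : 0 < x'' * x'' + y'' * y'' + z'' * z'') : g x y z := by
    have := hg.triple _ _ _ _ _ _ _ _ _ h₁ h₂ h₃ n₁.ne' n₂.ne' n₃.ne'
    tauto
  have h₅ : g 1 0 s := force hy (hg.pair (x' := -s) (y' := 0) (z' := 1) hxyz (by linarith))
    (by linarith) (by linarith) (by linarith) (by linarith) (by linarith) (by linarith)
  have h₆ : g s 1 1 := force hyz' (hg.pair (x' := -s) (y' := 1) (z' := 1) h₅ (by linarith))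
    (by linarith) (by linarith) (by linarith) (by linarith) (by linarith) (by linarith)
  have h₇ : g s 0 1 := force hy (hg.pair (x' := -1) (y' := 0) (z' := s) h₆ (by linarith))
    (by linarith) (by linarith) (by linarith) (by linarith) (by linarith) (by linarith)
  have h₈ : g 1 1 s := force hxy (hg.pair (x' := -1) (y' := -1) (z' := s) h₇ (by linarith))
    (by linarith) (by linarith) (by linarith) (by linarith) (by linarith) (by linarith)
  have h₉ : g 0 1 s := force hx (hg.pair (x' := 0) (y' := -s) (z' := 1) h₈ (by linarith))
    (by linarith) (by linarith) (by linarith) (by linarith) (by linarith) (by linarith)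
  have h₁₀ : g 1 s 1 := force hxz' (hg.pair (x' := 1) (y' := -s) (z' := 1) h₉ (by linarith))
    (by linarith) (by linarith) (by linarith) (by linarith) (by linarith) (by linarith)
  exact hx (force (hg.pair (x' := 0) (y' := s) (z' := 1) hxyz (by linarith))
    (hg.pair (x' := 0) (y' := -1) (z' := s) h₁₀ (by linarith))
    (by linarith) (by linarith) (by linarith) (by linarith) (by linarith) (by linarith))

lemma false_of_three (hg : IsKSColoring g) (hz : g 0 0 1) (hxz : g 1 0 1) (hyz : g 0 1 1) :
    False := by
  have hs : √2 * √2 = (2 : ℝ) := Real.mul_self_sqrt (by norm_num)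
  rcases hg.triple 1 (-1) √2 (-1) 1 √2 1 1 0 (by linarith) (by linarith) (by linarith)
    (by linarith) (by linarith) (by linarith) with h | h | h
  · exact hg.false_of_peres hs hz hxz hyz h
  · exact hg.swap.false_of_peres hs hz hyz hxz h
  · exact hg.pair hz (by norm_num) h

lemma false_of_two (hg : IsKSColoring g) (hz : g 0 0 1) (hxz : g 1 0 1) : False := by
  rcases hg.triple 0 1 1 0 (-1) 1 1 0 0 (by norm_num) (by norm_num) (by norm_num)
    (by norm_num) (by norm_num) (by norm_num) with h | h | h
  · exact hg.false_of_three hz hxz h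
  · exact hg.swap.reflect.swap.false_of_three (by simpa using hz) (by simpa using hxz)
      (by simpa using h)
  · exact hg.pair hz (by norm_num) h

lemma not_axis (hg : IsKSColoring g) : ¬ g 0 0 1 := by
  intro hz
  rcases hg.triple 1 0 1 (-1) 0 1 0 1 0 (by norm_num) (by norm_num) (by norm_num)
    (by norm_num) (by norm_num) (by norm_num) with h | h | h
  · exact hg.false_of_two hz h
  · exact hg.reflect.false_of_two (by simpa using hz) (by simpa using h)
  · exact hg.pair hz (by norm_num) h

end IsKSColoring

/-- **Kochen–Specker theorem** in dimension three. -/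
theorem not_isKSColoring (g : ℝ → ℝ → ℝ → Prop) : ¬ IsKSColoring g := by
  intro hg
  rcases hg.triple 0 0 1 1 0 0 0 1 0 (by norm_num) (by norm_num) (by norm_num)
    (by norm_num) (by norm_num) (by norm_num) with h | h | h
  · exact hg.not_axis h
  · exact hg.rotate.not_axis h
  · exact hg.rotate.rotate.not_axis h

section Projections

variable {H : Type*} [NormedAddCommGroup H] [InnerProductSpace ℂ H]

instance finiteDimensional_span_range {κ : Type*} [Finite κ] (v : κ → H) :
    FiniteDimensional ℂ (Submodule.span ℂ (Set.range v)) :=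
  FiniteDimensional.span_of_finite ℂ (Set.finite_range v)

lemma isOrtho_span_singleton {u v : H} (h : inner ℂ u v = 0) : (ℂ ∙ u) ⟂ (ℂ ∙ v) := by
  rw [Submodule.isOrtho_span]
  rintro _ rfl _ rfl
  exact h

lemma isProjection_starProjection [CompleteSpace H] (U : Submodule ℂ H) [U.HasOrthogonalProjection] :
    IsProjection U.starProjection :=
  ⟨isSelfAdjoint_starProjection U, U.isIdempotentElem_starProjection⟩

lemma Submodule.IsOrtho.starProjection_sup {U V : Submodule ℂ H} [U.HasOrthogonalProjection]
    [V.HasOrthogonalProjection] [(U ⊔ V).HasOrthogonalProjection] (h : U ⟂ V) :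
    (U ⊔ V).starProjection = U.starProjection + V.starProjection := by
  ext x
  refine Submodule.eq_starProjection_of_mem_orthogonal
    (Submodule.add_mem_sup (U.starProjection_apply_mem x) (V.starProjection_apply_mem x)) ?_
  rw [← Submodule.inf_orthogonal, add_apply]
  constructor
  · rw [← sub_sub]
    exact Submodule.sub_mem _ (U.sub_starProjection_mem_orthogonal x)
      (h.ge (V.starProjection_apply_mem x))
  · rw [add_comm, ← sub_sub]
    exact Submodule.sub_mem _ (V.sub_starProjection_mem_orthogonal x)
      (h.le (U.starProjection_apply_mem x))

lemma isProjection_zero [CompleteSpace H] : IsProjection (0 : H →L[ℂ] H) :=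
  ⟨IsSelfAdjoint.zero _, by simp⟩

/-- In dimension at least three, every unit vector extends to an orthonormal triple. -/
lemma exists_orthonormal_three (hdim : 3 ≤ Module.rank ℂ H) {u : H} (hu : ‖u‖ = 1) :
    ∃ e : Fin 3 → H, Orthonormal ℂ e ∧ e 0 = u := by
  have key (s : Finset H) (hs : s.card < 3) : ∃ v : H, ‖v‖ = 1 ∧ ∀ x ∈ s, inner ℂ x v = 0 := by
    have hne : (Submodule.span ℂ (s : Set H))ᗮ ≠ ⊥ := by
      rw [Ne, Submodule.orthogonal_eq_bot_iff]
      intro htop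
      have h := rank_span_finset_le (R := ℂ) s
      rw [htop, rank_top] at h
      exact absurd (Nat.cast_le.1 (hdim.trans h)) (not_le.2 hs)
    obtain ⟨v, hv, hv0⟩ := Submodule.exists_mem_ne_zero_of_ne_bot hne
    refine ⟨((‖v‖ : ℂ)⁻¹) • v, norm_smul_inv_norm hv0, fun x hx => ?_⟩
    rw [inner_smul_right, hv x (Submodule.subset_span hx), mul_zero]
  classical
  obtain ⟨v, hv, huv⟩ := key {u} (by simp)
  obtain ⟨w, hw, huw⟩ := key {u, v} (Finset.card_le_two.trans_lt (by norm_num))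
  simp only [Finset.mem_insert, Finset.mem_singleton, forall_eq_or_imp, forall_eq] at huv huw
  refine ⟨![u, v, w], ⟨fun i => by fin_cases i <;> simpa, fun i j hij => ?_⟩, rfl⟩
  have huv' := inner_eq_zero_symm.1 huv
  have huw' := inner_eq_zero_symm.1 huw.1
  have hvw' := inner_eq_zero_symm.1 huw.2
  fin_cases i <;> fin_cases j <;> simp_all

lemma span_range_eq_of_orthogonal {e v : Fin 3 → H} (hv0 : ∀ i, v i ≠ 0)
    (hv : Pairwise fun i j => inner ℂ (v i) (v j) = 0)
    (hmem : ∀ i, v i ∈ Submodule.span ℂ (Set.range e)) :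
    Submodule.span ℂ (Set.range v) = Submodule.span ℂ (Set.range e) := by
  refine Submodule.eq_of_le_of_finrank_le
    (Submodule.span_le.2 (Set.range_subset_iff.2 hmem)) ?_
  rw [finrank_span_eq_card (linearIndependent_of_ne_zero_of_inner_eq_zero hv0 hv)]
  exact finrank_range_le_card e

namespace IsISA

variable [CompleteSpace H] {Ψ : (H →L[ℂ] H) → ℝ}

lemma map_zero (hΨ : IsISA Ψ) : Ψ 0 = 0 := by
  have h := hΨ.2.2 (fun _ => 0) 0 (fun _ => isProjection_zero) isProjection_zero (by simp)
    (by simp [hasSum_zero])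
  exact (summable_const_iff _).1 h.summable

lemma starProjection_sup (hΨ : IsISA Ψ) {U V : Submodule ℂ H} [U.HasOrthogonalProjection]
    [V.HasOrthogonalProjection] [(U ⊔ V).HasOrthogonalProjection] (h : U ⟂ V) :
    Ψ (U ⊔ V).starProjection = Ψ U.starProjection + Ψ V.starProjection := by
  let P : ℕ → H →L[ℂ] H
    | 0 => U.starProjection
    | 1 => V.starProjection
    | _ + 2 => 0
  have hmem (n : ℕ) (hn : n ∉ Finset.range 2) : P n = 0 := by
    obtain ⟨m, rfl⟩ := Nat.exists_eq_add_of_le' (not_lt.1 (mt Finset.mem_range.2 hn))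
    rfl
  have hP : HasSum (fun n => Ψ (P n)) (Ψ (U ⊔ V).starProjection) := by
    refine hΨ.2.2 P _ ?_ (isProjection_starProjection _) ?_ fun x => ?_
    · rintro (_ | _ | n)
      exacts [isProjection_starProjection U, isProjection_starProjection V, isProjection_zero]
    · rintro (_ | _ | i) (_ | _ | j) hij
      · exact absurd rfl hij
      · exact h.starProjection_comp_starProjection
      · exact ContinuousLinearMap.comp_zero _
      · exact h.symm.starProjection_comp_starProjection
      · exact absurd rfl hij
      · exact ContinuousLinearMap.comp_zero _
      all_goals exact ContinuousLinearMap.zero_comp _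
    · have := hasSum_sum_of_ne_finset_zero (f := fun n => P n x) (s := Finset.range 2)
        (L := .unconditional ℕ) fun n hn => by simp [hmem n hn]
      simpa [Finset.sum_range_succ, P, h.starProjection_sup] using this
  have hsum := hasSum_sum_of_ne_finset_zero (f := fun n => Ψ (P n)) (s := Finset.range 2)
    (L := .unconditional ℕ) fun n hn => by simp [hmem n hn, hΨ.map_zero]
  simpa [Finset.sum_range_succ, P] using hP.unique hsum

lemma starProjection_nonneg (hΨ : IsISA Ψ) (U : Submodule ℂ H) [U.HasOrthogonalProjection] :
    0 ≤ Ψ U.starProjection :=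
  (hΨ.1 _ (isProjection_starProjection U)).1

lemma starProjection_le_one (hΨ : IsISA Ψ) (U : Submodule ℂ H) [U.HasOrthogonalProjection] :
    Ψ U.starProjection ≤ 1 :=
  (hΨ.1 _ (isProjection_starProjection U)).2

lemma starProjection_span_range (hΨ : IsISA Ψ) {v : Fin 3 → H}
    (hv : Pairwise fun i j => inner ℂ (v i) (v j) = 0) :
    Ψ (Submodule.span ℂ (Set.range v)).starProjection =
      Ψ (ℂ ∙ v 0).starProjection + Ψ (ℂ ∙ v 1).starProjection + Ψ (ℂ ∙ v 2).starProjection := by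
  have ho {i j : Fin 3} (hij : i ≠ j) : (ℂ ∙ v i) ⟂ (ℂ ∙ v j) :=
    isOrtho_span_singleton (hv hij)
  have hspan : Submodule.span ℂ (Set.range v) = ((ℂ ∙ v 0) ⊔ (ℂ ∙ v 1)) ⊔ (ℂ ∙ v 2) := by
    rw [Submodule.span_range_eq_iSup]
    simp [iSup_fin_three]
  rw [← hΨ.starProjection_sup (ho (by decide)), ← hΨ.starProjection_sup]
  · congr 1
    simp only [hspan]
  · exact Submodule.isOrtho_sup_left.2 ⟨ho (by decide), ho (by decide)⟩

/-- Some vector of a countable Hilbert basis spans a ray of nonzero value. -/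
lemma exists_basis_ne_zero (hΨ : IsISA Ψ) {ι : Type*} [Countable ι] (b : HilbertBasis ι ℂ H) :
    ∃ i, Ψ (ℂ ∙ b i).starProjection ≠ 0 := by
  by_contra! hall
  obtain ⟨f, hf⟩ := Countable.exists_injective_nat ι
  let R : ι → H →L[ℂ] H := fun i => (ℂ ∙ b i).starProjection
  let P : ℕ → H →L[ℂ] H := Function.extend f R fun _ => 0
  have hP (n : ℕ) : (∃ i, f i = n ∧ P n = R i) ∨ P n = 0 := by
    by_cases hn : ∃ i, f i = n
    · obtain ⟨i, rfl⟩ := hn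
      exact .inl ⟨i, rfl, hf.extend_apply R _ i⟩
    · exact .inr (Function.extend_apply' R _ n hn)
  have hsum : HasSum (fun n => Ψ (P n)) (Ψ 1) := by
    refine hΨ.2.2 P 1 (fun n => ?_) ⟨IsSelfAdjoint.one _, by ext; rfl⟩ (fun m n hmn => ?_)
      fun x => ?_
    · obtain ⟨i, -, hi⟩ | h0 := hP n
      · exact hi ▸ isProjection_starProjection _
      · exact h0 ▸ isProjection_zero
    · obtain ⟨i, rfl, hi⟩ | h0 := hP m
      · obtain ⟨j, rfl, hj⟩ | h0 := hP n
        · rw [hi, hj]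
          refine Submodule.IsOrtho.starProjection_comp_starProjection
            (isOrtho_span_singleton (b.orthonormal.2 ?_))
          rintro rfl
          exact hmn rfl
        · rw [h0, ContinuousLinearMap.comp_zero]
      · rw [h0, ContinuousLinearMap.zero_comp]
    · have hx := b.hasSum_repr x
      rw [← hf.hasSum_iff (f := fun n => P n x)]
      · convert hx using 2 with i
        · simp only [Function.comp_apply, P, hf.extend_apply, R]
          rw [Submodule.starProjection_unit_singleton ℂ (b.orthonormal.1 i), b.repr_apply_apply]
        · rfl
      · intro n hn
        simp only [P]
        rw [Function.extend_apply' _ _ _ hn]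
        rfl
  have h0 (n : ℕ) : Ψ (P n) = 0 := by
    obtain ⟨i, -, hi⟩ | h0 := hP n
    · rw [hi, hall]
    · rw [h0, hΨ.map_zero]
  simp only [h0, hΨ.2.1] at hsum
  exact one_ne_zero (hsum.unique hasSum_zero)

/-- A two-valued state which is nonzero on the span of an orthonormal triple colours the real
vectors in that span. -/
lemma isKSColoring (hΨ : IsISA Ψ) (hval : ∀ P, IsProjection P → Ψ P = 0 ∨ Ψ P = 1)
    {e : Fin 3 → H} (he : Orthonormal ℂ e) (h0 : Ψ (ℂ ∙ e 0).starProjection ≠ 0) :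
    IsKSColoring fun x y z =>
      Ψ (ℂ ∙ ((x : ℂ) • e 0 + (y : ℂ) • e 1 + (z : ℂ) • e 2)).starProjection = 1 := by
  have hinner (x y z x' y' z' : ℝ) :
      inner ℂ ((x : ℂ) • e 0 + (y : ℂ) • e 1 + (z : ℂ) • e 2)
        ((x' : ℂ) • e 0 + (y' : ℂ) • e 1 + (z' : ℂ) • e 2) =
      ((x * x' + y * y' + z * z' : ℝ) : ℂ) := by
    simp [orthonormal_iff_ite.1 he, he.1]
    ring
  have hspan : Ψ (Submodule.span ℂ (Set.range e)).starProjection = 1 := by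
    refine (hval _ (isProjection_starProjection _)).resolve_left fun h => h0 ?_
    rw [hΨ.starProjection_span_range fun i j => he.2 (i := i) (j := j)] at h
    linarith [hΨ.starProjection_nonneg (ℂ ∙ e 0), hΨ.starProjection_nonneg (ℂ ∙ e 1),
      hΨ.starProjection_nonneg (ℂ ∙ e 2)]
  refine ⟨fun {x y z x' y' z'} h horth h' => ?_, ?_⟩
  · have hsup := hΨ.starProjection_sup (isOrtho_span_singleton
      ((hinner x y z x' y' z').trans (by rw [horth, Complex.ofReal_zero])))
    rw [h, h'] at hsup
    linarith [hΨ.starProjection_le_one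
      ((ℂ ∙ ((x : ℂ) • e 0 + (y : ℂ) • e 1 + (z : ℂ) • e 2)) ⊔
        (ℂ ∙ ((x' : ℂ) • e 0 + (y' : ℂ) • e 1 + (z' : ℂ) • e 2)))]
  · intro x y z x' y' z' x'' y'' z'' h₁ h₂ h₃ n₁ n₂ n₃
    let v : Fin 3 → H := ![(x : ℂ) • e 0 + (y : ℂ) • e 1 + (z : ℂ) • e 2,
      (x' : ℂ) • e 0 + (y' : ℂ) • e 1 + (z' : ℂ) • e 2,
      (x'' : ℂ) • e 0 + (y'' : ℂ) • e 1 + (z'' : ℂ) • e 2]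
    have hv : Pairwise fun i j => inner ℂ (v i) (v j) = 0 := by
      intro i j hij
      have hz {r : ℝ} (hr : r = 0) : (r : ℂ) = 0 := by rw [hr, Complex.ofReal_zero]
      fin_cases i <;> fin_cases j <;> first
        | exact absurd rfl hij
        | exact (hinner ..).trans (hz (by linarith))
    have hv0 (i : Fin 3) : v i ≠ 0 := by
      rw [← inner_self_ne_zero (𝕜 := ℂ)]
      fin_cases i
      · exact (hinner ..).trans_ne (Complex.ofReal_ne_zero.2 n₁)
      · exact (hinner ..).trans_ne (Complex.ofReal_ne_zero.2 n₂)
      · exact (hinner ..).trans_ne (Complex.ofReal_ne_zero.2 n₃)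
    have hmem (i : Fin 3) : v i ∈ Submodule.span ℂ (Set.range e) := by
      have hlin (x y z : ℂ) : x • e 0 + y • e 1 + z • e 2 ∈ Submodule.span ℂ (Set.range e) := by
        have hei (i : Fin 3) := Submodule.subset_span (R := ℂ) (Set.mem_range_self (f := e) i)
        exact add_mem (add_mem (Submodule.smul_mem _ _ (hei 0)) (Submodule.smul_mem _ _ (hei 1)))
          (Submodule.smul_mem _ _ (hei 2))
      fin_cases i <;> exact hlin _ _ _
    have hsum := hΨ.starProjection_span_range hv
    simp only [span_range_eq_of_orthogonal hv0 hv hmem, hspan] at hsum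
    by_contra! hne
    have hzero (w : H) (hw : Ψ (ℂ ∙ w).starProjection ≠ 1) : Ψ (ℂ ∙ w).starProjection = 0 :=
      (hval _ (isProjection_starProjection _)).resolve_right hw
    have z₁ := hzero (v 0) hne.1
    have z₂ := hzero (v 1) hne.2.1
    have z₃ := hzero (v 2) hne.2.2
    linarith

end IsISA

end Projections

/-- Let `H` be a separable complex Hilbert space (separability being witnessed
by a Hilbert basis `b` indexed by a countable type) with `dim H ≥ 3`. Then there is no Intensive
State of Affairs on `H` taking only the values `0` and `1`: Gleason's theorem excludes any
`{0,1}`-valued countably additive probability assignment on the orthogonal projections of `H`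
with `Ψ 1 = 1`. -/
theorem no_two_valued_isa {H : Type*} [NormedAddCommGroup H] [InnerProductSpace ℂ H]
    [CompleteSpace H] {ι : Type*} [Countable ι] (b : HilbertBasis ι ℂ H)
    (hdim : 3 ≤ Module.rank ℂ H) :
    ¬ ∃ Ψ : (H →L[ℂ] H) → ℝ, IsISA Ψ ∧
        ∀ P : H →L[ℂ] H, IsProjection P → Ψ P = 0 ∨ Ψ P = 1 := by
  rintro ⟨Ψ, hΨ, hval⟩
  obtain ⟨i, hi⟩ := hΨ.exists_basis_ne_zero b
  obtain ⟨e, he, he0⟩ := exists_orthonormal_three hdim (b.orthonormal.1 i)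
  exact not_isKSColoring _ (hΨ.isKSColoring hval he (by simpa only [he0] using hi))
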